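/- arXiv:math/0509036 — 2 statements merged into one kernel-verified Lean document; each statement's English description precedes it below -/
import Mathlib

section
/- Let G be a finitely generated group and let p be a prime. Then the following are equivalent: (i) G has an infinite strictly nested sequence of subnormal subgroups, each with index a power of p in G, with linear growth of mod p homology; (ii) limsup_{n→∞} (log a_{p^n}^{⊳⊳}(G))/p^n > 0; (iii) inf_{n≥1} (log a_{p^n}^{⊳⊳}(G))/p^n > 0. -/
open scoped TensorProduct

/-- mod p homology dimension -/
noncomputable def dp (p : ℕ) (G : Type*) [Group G] : ℕ :=
  Module.finrank (ZMod p) (ZMod p ⊗[ℤ] Additive (Abelianization G))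

def IsSubnormal {G : Type*} [Group G] (H : Subgroup G) : Prop :=
  ∃ (n : ℕ) (c : ℕ → Subgroup G), c 0 = H ∧ c n = ⊤ ∧
    ∀ i < n, c i ≤ c (i + 1) ∧ ∀ g ∈ c (i + 1), ∀ x ∈ c i, g * x * g⁻¹ ∈ c i

def IsFinitelyPresented (G : Type*) [Group G] : Prop :=
  ∃ (n : ℕ) (R : Finset (FreeGroup (Fin n))) (f : FreeGroup (Fin n) →* G),
    Function.Surjective f ∧ f.ker = Subgroup.normalClosure (R : Set (FreeGroup (Fin n)))

def IsLarge (G : Type*) [Group G] : Prop :=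
  ∃ H : Subgroup G, H.FiniteIndex ∧ ∃ f : H →* FreeGroup (Fin 2), Function.Surjective f

def schreierBoundary (G : Type*) [Group G] (S : Set G) (H : Subgroup G)
    (A : Set (G ⧸ H)) : Set (G × (G ⧸ H)) :=
  {e | e.1 ∈ S ∧ ((e.2 ∈ A) ≠ (e.1 • e.2 ∈ A))}

noncomputable def cheeger (G : Type*) [Group G] (S : Set G) (H : Subgroup G) : ℝ :=
  sInf {r : ℝ | ∃ A : Set (G ⧸ H), A.Nonempty ∧
    2 * (Nat.card A : ℝ) ≤ (Nat.card (G ⧸ H) : ℝ) ∧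
    r = (Nat.card (schreierBoundary G S H A) : ℝ) / (Nat.card A : ℝ)}

def PropertyTau (G : Type*) [Group G] {ι : Type*} (Gs : ι → Subgroup G) : Prop :=
  ∃ S : Finset G, Subgroup.closure (S : Set G) = ⊤ ∧
    ∃ ε : ℝ, 0 < ε ∧ ∀ i, ε ≤ cheeger G (S : Set G) (Gs i)

def LinearGrowthModP (p : ℕ) {G : Type*} [Group G] (Gs : ℕ → Subgroup G) : Prop :=
  ∃ c : ℝ, 0 < c ∧ ∀ i, c ≤ (dp p ↥(Gs i) : ℝ) / ((Gs i).index : ℝ)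

/-- `a_m^{⊳⊳}(G)`: the number of subnormal subgroups of `G` of index exactly `m`. -/
noncomputable def subnormalCount (G : Type*) [Group G] (m : ℕ) : ℕ :=
  Nat.card {H : Subgroup G // IsSubnormal H ∧ H.index = m}

/-! ### The space of homomorphisms to `ZMod p` -/

/-- homomorphisms from `H` to `ZMod p`, as a space of functions -/
def VV (p : ℕ) (H : Type*) [Group H] : Submodule (ZMod p) (H → ZMod p) where
  carrier := {f | ∀ x y, f (x * y) = f x + f y}
  add_mem' := by
    intro a b ha hb x y
    simp only [Pi.add_apply, ha x y, hb x y]; ring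
  zero_mem' := by intro x y; simp
  smul_mem' := by
    intro c a ha x y
    simp only [Pi.smul_apply, ha x y, smul_add]

section VVbasic

variable {p : ℕ} {H : Type*} [Group H]

theorem VV_mul (f : VV p H) (x y : H) : f.1 (x * y) = f.1 x + f.1 y := f.2 x y

theorem VV_one (f : VV p H) : f.1 1 = 0 := by
  have := VV_mul f 1 1
  simpa using this

theorem VV_inv (f : VV p H) (x : H) : f.1 x⁻¹ = - f.1 x := by
  have := VV_mul f x⁻¹ x
  rw [inv_mul_cancel, VV_one] at this
  exact eq_neg_of_add_eq_zero_left this.symm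

theorem VV_zpow (f : VV p H) (x : H) (n : ℤ) : f.1 (x ^ n) = n * f.1 x := by
  induction n using Int.induction_on with
  | zero => simp [VV_one]
  | succ i ih => rw [zpow_add_one, VV_mul, ih]; push_cast; ring
  | pred i ih => rw [zpow_sub_one, VV_mul, ih, VV_inv]; push_cast; ring

theorem VV_conj (f : VV p H) (x y : H) : f.1 (x * y * x⁻¹) = f.1 y := by
  rw [VV_mul, VV_mul, VV_inv]; ring

/-- the kernel of a homomorphism -/
def VVker (f : VV p H) : Subgroup H where
  carrier := {h | f.1 h = 0}
  mul_mem' := by intro a b ha hb; simp only [Set.mem_ofPred_eq] at *; rw [VV_mul, ha, hb, add_zero]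
  one_mem' := VV_one f
  inv_mem' := by intro a ha; simp only [Set.mem_ofPred_eq] at *; rw [VV_inv, ha, neg_zero]

theorem mem_VVker (f : VV p H) (h : H) : h ∈ VVker f ↔ f.1 h = 0 := Iff.rfl

/-- associated monoid hom -/
def VVhom (f : VV p H) : H →* Multiplicative (ZMod p) where
  toFun h := Multiplicative.ofAdd (f.1 h)
  map_one' := by simp [VV_one]
  map_mul' x y := by simp [VV_mul]

theorem VV_ext_closure {S : Set H} (hS : Subgroup.closure S = ⊤) (f g : VV p H)
    (h : ∀ s ∈ S, f.1 s = g.1 s) : f = g := by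
  have : Subgroup.closure S ≤ VVker (f - g) := by
    rw [Subgroup.closure_le]
    intro s hs
    change f.1 s - g.1 s = 0
    rw [h s hs, sub_self]
  rw [hS] at this
  apply Subtype.ext
  funext x
  have hx := this (Subgroup.mem_top x)
  exact sub_eq_zero.mp hx

theorem VV_finite [NeZero p] (hH : Group.FG H) : Finite (VV p H) := by
  obtain ⟨S, hS⟩ := hH.out
  have : Finite (S → ZMod p) := inferInstance
  refine Finite.of_injective (fun f : VV p H => fun s : S => f.1 s) ?_
  intro f g hfg
  refine VV_ext_closure hS f g ?_
  intro s hs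
  exact congrFun hfg ⟨s, hs⟩

/-- transport along an isomorphism -/
theorem VV_finrank_congr {H' : Type*} [Group H'] (e : H ≃* H') :
    Module.finrank (ZMod p) (VV p H) = Module.finrank (ZMod p) (VV p H') := by
  refine LinearEquiv.finrank_eq (LinearEquiv.ofBijective
    ({ toFun := fun f => ⟨fun h => f.1 (e.symm h), fun x y => by simp only [map_mul, VV_mul]⟩
       map_add' := fun _ _ => rfl
       map_smul' := fun _ _ => rfl } : VV p H →ₗ[ZMod p] VV p H') ⟨?_, ?_⟩)
  · intro f g hfg
    apply Subtype.ext
    funext x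
    have := congrFun (congrArg Subtype.val hfg) (e x)
    simpa using this
  · intro g
    refine ⟨⟨fun h => g.1 (e h), fun x y => by simp only [map_mul, VV_mul]⟩, ?_⟩
    apply Subtype.ext
    funext x
    simp

theorem dp_eq [Fact p.Prime] : dp p H = Module.finrank (ZMod p) (VV p H) := by
  unfold dp
  rw [← Subspace.dual_finrank_eq]
  refine LinearEquiv.finrank_eq
    ((LinearMap.liftBaseChangeEquiv (R := ℤ) (M := Additive (Abelianization H))
      (N := ZMod p) (ZMod p)).symm.trans (LinearEquiv.ofBijective
    ({ toFun := fun f => ⟨fun h => f (Additive.ofMul (Abelianization.of h)),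
          fun x y => by simp⟩
       map_add' := fun _ _ => rfl
       map_smul' := fun _ _ => rfl } :
         (Additive (Abelianization H) →ₗ[ℤ] ZMod p) →ₗ[ZMod p] VV p H) ⟨?_, ?_⟩))
  · intro f g hfg
    ext a
    obtain ⟨h, hh⟩ := QuotientGroup.mk_surjective (Additive.toMul a)
    have := congrFun (congrArg Subtype.val hfg) h
    have e : a = Additive.ofMul (Abelianization.of h) := by
      exact (congrArg Additive.ofMul hh).symm
    rw [e]
    exact this
  · intro g
    refine ⟨(AddMonoidHom.toIntLinearMap
      (MonoidHom.toAdditiveLeft (Abelianization.lift (VVhom g)))), ?_⟩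
    apply Subtype.ext
    funext x
    simp [VVhom]

end VVbasic

/-! ### Evaluation and nilpotent operators -/

section LinAlg

variable {k : Type*} [Field k] {V : Type*} [AddCommGroup V] [Module k V] [FiniteDimensional k V]

theorem finrank_ker_functional (φ : V →ₗ[k] k) (v : V) (hv : φ v ≠ 0) :
    Module.finrank k (LinearMap.ker φ) + 1 = Module.finrank k V := by
  have h := LinearMap.finrank_range_add_finrank_ker φ
  have hs : LinearMap.range φ = ⊤ := by
    rw [LinearMap.range_eq_top]
    apply LinearMap.surjective
    intro h0
    rw [h0] at hv
    exact hv rfl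
  rw [hs, finrank_top, Module.finrank_self] at h
  omega

theorem finrank_ker_functional_le (φ : V →ₗ[k] k) :
    Module.finrank k V ≤ Module.finrank k (LinearMap.ker φ) + 1 := by
  have h := LinearMap.finrank_range_add_finrank_ker φ
  have := Submodule.finrank_le (LinearMap.range φ)
  rw [Module.finrank_self] at this
  omega

theorem finrank_ker_pow_le (N : V →ₗ[k] V) (j : ℕ) :
    Module.finrank k (LinearMap.ker (N ^ j)) ≤ j * Module.finrank k (LinearMap.ker N) := by
  induction j with
  | zero =>
    have : LinearMap.ker (N ^ 0) = ⊥ := by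
      rw [pow_zero]; exact LinearMap.ker_id
    rw [this]; simp
  | succ j ih =>
    let M : LinearMap.ker (N ^ (j + 1)) →ₗ[k] LinearMap.ker (N ^ j) :=
      N.restrict (by
        intro v hv
        rw [LinearMap.mem_ker] at *
        rw [pow_succ] at hv
        exact hv)
    have h := LinearMap.finrank_range_add_finrank_ker M
    have h1 := Submodule.finrank_le (LinearMap.range M)
    have h2 : Module.finrank k (LinearMap.ker M) ≤ Module.finrank k (LinearMap.ker N) := by
      let Q : LinearMap.ker M →ₗ[k] LinearMap.ker N :=
        { toFun := fun v => ⟨v.1.1, by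
            have := v.2
            rw [LinearMap.mem_ker] at this ⊢
            exact congrArg Subtype.val this⟩
          map_add' := fun _ _ => rfl
          map_smul' := fun _ _ => rfl }
      refine LinearMap.finrank_le_finrank_of_injective (f := Q) ?_
      intro a b hab
      apply Subtype.ext
      apply Subtype.ext
      exact congrArg (fun z : LinearMap.ker N => (z : V)) hab
    rw [add_mul, one_mul]
    omega

theorem finrank_le_of_pow_eq_zero (N : V →ₗ[k] V) (j : ℕ) (hN : N ^ j = 0) :
    Module.finrank k V ≤ j * Module.finrank k (LinearMap.ker N) := by
  have := finrank_ker_pow_le N j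
  rw [hN, LinearMap.ker_zero, finrank_top] at this
  exact this

theorem sub_one_pow_char (p : ℕ) [Fact p.Prime] {V : Type*} [AddCommGroup V] [Module (ZMod p) V]
    (T : V →ₗ[ZMod p] V) : (T - 1) ^ p = T ^ p - 1 := by
  have h : (Polynomial.X - 1 : Polynomial (ZMod p)) ^ p = Polynomial.X ^ p - 1 := by
    rw [sub_pow_char, one_pow]
  have := congrArg (Polynomial.aeval T) h
  simpa using this

end LinAlg

/-! ### Normal subgroups of index `p` -/

section Key

variable {p : ℕ} [Fact p.Prime] {H : Type*} [Group H]

theorem VVker_eq_ker (f : VV p H) : VVker f = (VVhom f).ker := by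
  ext h
  rw [mem_VVker, MonoidHom.mem_ker]
  exact Iff.rfl

theorem VVker_normal (f : VV p H) : (VVker f).Normal := by
  rw [VVker_eq_ker]; infer_instance

theorem VVhom_surjective (f : VV p H) (x : H) (hx : f.1 x ≠ 0) :
    Function.Surjective (VVhom f) := by
  intro y
  refine ⟨x ^ ((Multiplicative.toAdd y / f.1 x).val : ℤ), ?_⟩
  change Multiplicative.ofAdd (f.1 _) = y
  rw [VV_zpow]
  rw [Int.cast_natCast, ZMod.natCast_zmod_val, div_mul_cancel₀ _ hx]
  rfl

theorem VVker_index (f : VV p H) (x : H) (hx : f.1 x ≠ 0) : (VVker f).index = p := by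
  rw [VVker_eq_ker, Subgroup.index_ker, MonoidHom.range_eq_top.2 (VVhom_surjective f x hx),
    Nat.card_congr (Subgroup.topEquiv.toEquiv)]
  simp

theorem exists_VV_of_index (K : Subgroup H) [K.Normal] (hK : K.index = p) :
    ∃ f : VV p H, VVker f = K := by
  have h1 : Nat.card (H ⧸ K) = p := hK
  have h2 : Nat.card (Multiplicative (ZMod p)) = p := by simp
  let e : H ⧸ K ≃* Multiplicative (ZMod p) := mulEquivOfPrimeCardEq h1 h2
  refine ⟨⟨fun h => Multiplicative.toAdd (e (h : H ⧸ K)), fun x y => by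
    simp⟩, ?_⟩
  ext h
  rw [mem_VVker]
  simp

/-- extension of an invariant homomorphism -/
theorem extend_hom (K : Subgroup H) (φ : VV p H) (hφ : VVker φ = K) (x : H) (hx : φ.1 x = 1)
    (g : H → ZMod p) (hg : ∀ a ∈ K, ∀ b ∈ K, g (a * b) = g a + g b)
    (hc : ∀ a ∈ K, g (x * a * x⁻¹) = g a) (hxp : g (x ^ p) = 0) :
    ∃ F : VV p H, F.1 x = 0 ∧ ∀ a ∈ K, F.1 a = g a := by
  have hmem : ∀ h, h ∈ K ↔ φ.1 h = 0 := by
    intro h; rw [← hφ]; exact Iff.rfl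
  have hg1 : g 1 = 0 := by
    have := hg 1 K.one_mem 1 K.one_mem
    simpa using this
  have hconjmem : ∀ (n : ℤ) (a : H), a ∈ K → x ^ n * a * (x ^ n)⁻¹ ∈ K := by
    intro n a ha
    rw [hmem] at *
    rw [VV_conj, ha]
  have hpow : ∀ (n : ℤ), ∀ a ∈ K, g (x ^ n * a * (x ^ n)⁻¹) = g a := by
    intro n
    induction n using Int.induction_on with
    | zero => intro a _; simp
    | succ i ih =>
      intro a ha
      have e : x ^ ((i : ℤ) + 1) * a * (x ^ ((i : ℤ) + 1))⁻¹
          = x * (x ^ (i : ℤ) * a * (x ^ (i : ℤ))⁻¹) * x⁻¹ := by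
        rw [add_comm, zpow_add, zpow_one]; group
      rw [e, hc _ (hconjmem _ _ ha), ih a ha]
    | pred i ih =>
      intro a ha
      have e : x * (x ^ (-(i : ℤ) - 1) * a * (x ^ (-(i : ℤ) - 1))⁻¹) * x⁻¹
          = x ^ (-(i : ℤ)) * a * (x ^ (-(i : ℤ)))⁻¹ := by
        group
      rw [← hc _ (hconjmem _ _ ha), e, ih a ha]
  have hxpK : x ^ p ∈ K := by
    rw [hmem]
    have := VV_zpow φ x (p : ℤ)
    simpa using this
  have hmul : ∀ j : ℤ, g ((x ^ p) ^ j) = 0 := by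
    intro j
    induction j using Int.induction_on with
    | zero => simpa using hg1
    | succ i ih =>
      rw [zpow_add_one, hg _ (K.zpow_mem hxpK _) _ hxpK, ih, hxp, add_zero]
    | pred i ih =>
      have := hg ((x ^ p) ^ (-(i : ℤ) - 1)) (K.zpow_mem hxpK _) _ hxpK
      rw [← zpow_add_one, sub_add_cancel, ih, hxp, add_zero] at this
      exact this.symm
  -- independence of exponent
  have hind : ∀ (h : H) (n m : ℤ), h * x ^ (-n) ∈ K → h * x ^ (-m) ∈ K →
      g (h * x ^ (-n)) = g (h * x ^ (-m)) := by
    intro h n m hn hm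
    have hd : (p : ℤ) ∣ n - m := by
      rw [hmem, VV_mul, VV_zpow, hx] at hn hm
      rw [← ZMod.intCast_eq_intCast_iff_dvd_sub]
      push_cast at hn hm
      linear_combination hn - hm
    obtain ⟨j, hj⟩ := hd
    have e : h * x ^ (-m) = h * x ^ (-n) * (x ^ p) ^ j := by
      rw [← zpow_natCast x p, ← zpow_mul, ← hj, mul_assoc, ← zpow_add]
      congr 2; ring
    rw [e, hg _ hn _ (K.zpow_mem hxpK _), hmul, add_zero]
  have hval : ∀ h : H, h * x ^ (-((φ.1 h).val : ℤ)) ∈ K := by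
    intro h
    rw [hmem, VV_mul, VV_zpow, hx]
    push_cast
    simp
  refine ⟨⟨fun h => g (h * x ^ (-((φ.1 h).val : ℤ))), ?_⟩, ?_, ?_⟩
  · intro a b
    have e : a * b * x ^ (-(((φ.1 a).val : ℤ) + ((φ.1 b).val : ℤ)))
        = (a * x ^ (-((φ.1 a).val : ℤ))) *
          (x ^ ((φ.1 a).val : ℤ) * (b * x ^ (-((φ.1 b).val : ℤ))) * (x ^ ((φ.1 a).val : ℤ))⁻¹) := by
      group
    have hm : a * b * x ^ (-(((φ.1 a).val : ℤ) + ((φ.1 b).val : ℤ))) ∈ K := by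
      rw [e]
      exact K.mul_mem (hval a) (hconjmem _ _ (hval b))
    change g _ = g _ + g _
    rw [hind (a * b) _ _ (hval (a * b)) hm, e, hg _ (hval a) _ (hconjmem _ _ (hval b)),
      hpow _ _ (hval b)]
  · change g _ = 0
    rw [hind x _ 1 (hval x) (by simp [K.one_mem])]
    simpa using hg1
  · intro a ha
    change g _ = _
    rw [hind a _ 0 (hval a) (by simpa using ha)]
    simp

theorem key_ineq (hH : Group.FG H) (K : Subgroup H) [K.Normal] (hK : K.index = p) :
    Module.finrank (ZMod p) (VV p K) + p ≤ p * Module.finrank (ZMod p) (VV p H) + 1 := by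
  classical
  have hp : p.Prime := Fact.out
  have : Finite (VV p H) := VV_finite hH
  have : K.FiniteIndex := ⟨by rw [hK]; exact hp.ne_zero⟩
  have hKfg : Group.FG K := inferInstance
  have : Finite (VV p K) := VV_finite hKfg
  have : FiniteDimensional (ZMod p) (VV p H) := Module.Finite.of_finite
  have : FiniteDimensional (ZMod p) (VV p K) := Module.Finite.of_finite
  obtain ⟨φ₀, hφ₀⟩ := exists_VV_of_index K hK
  have hx : ∃ x, φ₀.1 x ≠ 0 := by
    by_contra hcon
    push Not at hcon
    have : K = ⊤ := by
      rw [← hφ₀, Subgroup.eq_top_iff']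
      exact hcon
    rw [this, Subgroup.index_top] at hK
    exact hp.one_lt.ne hK
  obtain ⟨x, hx⟩ := hx
  obtain ⟨φ, hφ, hφx⟩ : ∃ φ : VV p H, VVker φ = K ∧ φ.1 x = 1 := by
    refine ⟨(φ₀.1 x)⁻¹ • φ₀, ?_, ?_⟩
    · rw [← hφ₀]
      ext h
      rw [mem_VVker, mem_VVker]
      change (φ₀.1 x)⁻¹ * φ₀.1 h = 0 ↔ _
      simp [hx]
    · change (φ₀.1 x)⁻¹ * φ₀.1 x = 1
      exact inv_mul_cancel₀ hx
  have hxpK : x ^ p ∈ K := by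
    rw [← hφ, mem_VVker]
    have := VV_zpow φ x (p : ℤ)
    simpa using this
  have hcm : ∀ (y : H) (k : K), y * k.1 * y⁻¹ ∈ K := fun y k =>
    Subgroup.Normal.conj_mem inferInstance k.1 k.2 y
  -- conjugation
  let T : VV p K →ₗ[ZMod p] VV p K :=
    { toFun := fun f => ⟨fun k => f.1 ⟨x * k.1 * x⁻¹, hcm x k⟩, by
        intro a b
        rw [← VV_mul]
        refine congrArg f.1 (Subtype.ext ?_)
        simp⟩
      map_add' := fun _ _ => rfl
      map_smul' := fun _ _ => rfl }
  have hT : ∀ (n : ℕ) (f : VV p K) (k : K),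
      ((T ^ n) f).1 k = f.1 ⟨x ^ n * k.1 * (x ^ n)⁻¹, hcm _ k⟩ := by
    intro n
    induction n with
    | zero => intro f k; simp
    | succ n ih =>
      intro f k
      rw [pow_succ]
      change ((T ^ n) (T f)).1 k = _
      rw [ih]
      change f.1 _ = f.1 _
      refine congrArg f.1 (Subtype.ext ?_)
      simp [pow_succ', mul_assoc]
  have hTp : T ^ p = 1 := by
    apply LinearMap.ext
    intro f
    apply Subtype.ext
    funext k
    rw [hT]
    have := VV_conj f ⟨x ^ p, hxpK⟩ k
    exact this
  let ev : VV p K →ₗ[ZMod p] ZMod p :=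
    { toFun := fun f => f.1 ⟨x ^ p, hxpK⟩
      map_add' := fun _ _ => rfl
      map_smul' := fun _ _ => rfl }
  have hW : ∀ f ∈ LinearMap.ker ev, T f ∈ LinearMap.ker ev := by
    intro f hf
    rw [LinearMap.mem_ker] at *
    change f.1 _ = 0
    change f.1 _ = 0 at hf
    rw [← hf]
    refine congrArg f.1 (Subtype.ext ?_)
    simp [← pow_succ', pow_succ]
  let TW : LinearMap.ker ev →ₗ[ZMod p] LinearMap.ker ev := T.restrict hW
  have hTW : ∀ (n : ℕ) (f : LinearMap.ker ev), ((TW ^ n) f).1 = (T ^ n) f.1 := by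
    intro n
    induction n with
    | zero => intro f; rfl
    | succ n ih =>
      intro f
      rw [pow_succ, pow_succ]
      exact ih (TW f)
  have hTWp : TW ^ p = 1 := by
    apply LinearMap.ext
    intro f
    apply Subtype.ext
    rw [hTW, hTp]
    rfl
  have hN : (TW - 1) ^ p = 0 := by
    rw [sub_one_pow_char, hTWp, sub_self]
  have h1 := finrank_le_of_pow_eq_zero (TW - 1) p hN
  have h2 := finrank_ker_functional_le ev
  let evx : VV p H →ₗ[ZMod p] ZMod p :=
    { toFun := fun f => f.1 x
      map_add' := fun _ _ => rfl
      map_smul' := fun _ _ => rfl }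
  have h3 := finrank_ker_functional evx φ (by change φ.1 x ≠ 0; rw [hφx]; exact one_ne_zero)
  have h4 : Module.finrank (ZMod p) (LinearMap.ker (TW - 1))
      ≤ Module.finrank (ZMod p) (LinearMap.ker evx) := by
    let res : LinearMap.ker evx →ₗ[ZMod p] VV p K :=
      { toFun := fun F => ⟨fun k => F.1.1 k.1, fun a b => VV_mul F.1 a.1 b.1⟩
        map_add' := fun _ _ => rfl
        map_smul' := fun _ _ => rfl }
    let inc : LinearMap.ker (TW - 1) →ₗ[ZMod p] LinearMap.range res :=
      { toFun := fun f => ⟨f.1.1, by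
          have hf := f.2
          rw [LinearMap.mem_ker] at hf
          have hf' : TW f.1 = f.1 := sub_eq_zero.mp hf
          have hinv : ∀ k : K, f.1.1.1 ⟨x * k.1 * x⁻¹, hcm x k⟩ = f.1.1.1 k := by
            intro k
            exact congrFun (congrArg (fun z : LinearMap.ker ev => z.1.1) hf') k
          have hevf : f.1.1.1 ⟨x ^ p, hxpK⟩ = 0 := f.1.2
          obtain ⟨F, hFx, hF⟩ := extend_hom K φ hφ x hφx
            (fun h => if hh : h ∈ K then f.1.1.1 ⟨h, hh⟩ else 0)
            (by
              intro a ha b hb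
              simp only [ha, hb, K.mul_mem ha hb, dite_true]
              exact VV_mul f.1.1 ⟨a, ha⟩ ⟨b, hb⟩)
            (by
              intro a ha
              have := hcm x ⟨a, ha⟩
              simp only at this
              simp only [this, ha, dite_true]
              exact hinv ⟨a, ha⟩)
            (by
              simp only [hxpK, dite_true]
              exact hevf)
          refine ⟨⟨F, hFx⟩, ?_⟩
          apply Subtype.ext
          funext k
          change F.1 k.1 = _
          rw [hF k.1 k.2]
          simp⟩
        map_add' := fun _ _ => rfl
        map_smul' := fun _ _ => rfl }
    have hi : Function.Injective inc := by
      intro a b hab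
      apply Subtype.ext
      apply Subtype.ext
      exact congrArg (fun z : LinearMap.range res => (z : VV p K)) hab
    exact (LinearMap.finrank_le_finrank_of_injective hi).trans (LinearMap.finrank_range_le res)
  have h5 := Nat.mul_le_mul_left p h4
  rw [← h3, mul_add, mul_one]
  omega

end Key

/-! ### Subnormal subgroups of `p`-power index -/

section Subn

variable {G : Type*} [Group G]

/-- `K` is a normal subgroup of `H` of index `p` -/
def Step (p : ℕ) (K H : Subgroup G) : Prop :=
  K ≤ H ∧ (∀ g ∈ H, ∀ x ∈ K, g * x * g⁻¹ ∈ K) ∧ K.relIndex H = p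

/-- subnormal subgroups of index `p ^ n` -/
def SS (G : Type*) [Group G] (p n : ℕ) : Set (Subgroup G) :=
  {H | IsSubnormal H ∧ H.index = p ^ n}

theorem isSubnormal_prepend {K H : Subgroup G} (hH : IsSubnormal H) (hKH : K ≤ H)
    (hn : ∀ g ∈ H, ∀ x ∈ K, g * x * g⁻¹ ∈ K) : IsSubnormal K := by
  obtain ⟨n, c, h0, hn', hc⟩ := hH
  refine ⟨n + 1, fun i => Nat.casesOn i K c, rfl, hn', ?_⟩
  intro i hi
  cases i with
  | zero =>
    simp only
    rw [h0]
    exact ⟨hKH, hn⟩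
  | succ i => exact hc i (by omega)

theorem exists_above {H : Subgroup G} (hH : IsSubnormal H) (hne : H ≠ ⊤) :
    ∃ L : Subgroup G, IsSubnormal L ∧ H < L ∧ ∀ g ∈ L, ∀ x ∈ H, g * x * g⁻¹ ∈ H := by
  obtain ⟨n, c, h0, hn, hc⟩ := hH
  induction n generalizing c with
  | zero => exact absurd (h0.symm.trans hn) hne
  | succ n ih =>
    have hc0 := hc 0 (by omega)
    rw [h0] at hc0
    by_cases he : c 1 = H
    · exact ih (fun i => c (i + 1)) he hn (fun i hi => hc (i + 1) (by omega))
    · exact ⟨c 1, ⟨n, fun i => c (i + 1), rfl, hn, fun i hi => hc (i + 1) (by omega)⟩,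
        lt_of_le_of_ne hc0.1 (Ne.symm he), hc0.2⟩

theorem exists_step {p : ℕ} (hp : p.Prime) {n : ℕ} {H : Subgroup G} (hH : H ∈ SS G p (n + 1)) :
    ∃ H' ∈ SS G p n, Step p H H' := by
  have : Fact p.Prime := ⟨hp⟩
  obtain ⟨hsub, hidx⟩ := hH
  have hne : H ≠ ⊤ := by
    rintro rfl
    rw [Subgroup.index_top] at hidx
    exact (Nat.one_lt_pow (by omega) hp.one_lt).ne hidx
  obtain ⟨L, hL, hlt, hnorm⟩ := exists_above hsub hne
  have hN : (H.subgroupOf L).Normal := by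
    refine ⟨fun x hx g => ?_⟩
    rw [Subgroup.mem_subgroupOf] at *
    exact hnorm g.1 g.2 x.1 hx
  have hri : (H.relIndex L) * L.index = H.index := Subgroup.relIndex_mul_index hlt.le
  have hcard : Nat.card (L ⧸ H.subgroupOf L) = H.relIndex L := rfl
  obtain ⟨j, -, hj⟩ := (Nat.dvd_prime_pow hp).1 (hidx ▸ Dvd.intro _ hri : H.relIndex L ∣ p ^ (n + 1))
  have hj0 : j ≠ 0 := by
    rintro rfl
    rw [pow_zero, Subgroup.relIndex_eq_one] at hj
    exact hlt.not_ge hj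
  have hQ : IsPGroup p (L ⧸ H.subgroupOf L) := IsPGroup.of_card (hcard.trans hj)
  have hfin : Finite (L ⧸ H.subgroupOf L) := Nat.finite_of_card_ne_zero (by
    rw [hcard, hj]; exact pow_ne_zero _ hp.ne_zero)
  have hnt : Nontrivial (L ⧸ H.subgroupOf L) := by
    rw [← Finite.one_lt_card_iff_nontrivial, hcard, hj]
    exact Nat.one_lt_pow hj0 hp.one_lt
  have hcn := hQ.center_nontrivial
  have hdvd : p ∣ Nat.card (Subgroup.center (L ⧸ H.subgroupOf L)) := by
    obtain ⟨m, hm⟩ := (IsPGroup.iff_card (p := p)).1 (hQ.to_subgroup (Subgroup.center _))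
    rw [hm]
    apply dvd_pow_self
    rintro rfl
    have := Finite.one_lt_card_iff_nontrivial.2 hcn
    rw [hm, pow_zero] at this
    exact lt_irrefl _ this
  obtain ⟨z, hz⟩ := exists_prime_orderOf_dvd_card' p hdvd
  let Z : Subgroup (L ⧸ H.subgroupOf L) := Subgroup.zpowers z.1
  have hZcard : Nat.card Z = p := by
    rw [Nat.card_zpowers, Subgroup.orderOf_coe, hz]
  have hZc : Z ≤ Subgroup.center _ := by
    rw [Subgroup.zpowers_le]; exact z.2
  have hZn : ∀ g, ∀ y ∈ Z, g * y * g⁻¹ ∈ Z := by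
    intro g y hy
    have := Subgroup.mem_center_iff.1 (hZc hy) g
    rw [this, mul_inv_cancel_right]
    exact hy
  let H'' : Subgroup L := Z.comap (QuotientGroup.mk' (H.subgroupOf L))
  have hidx'' : H''.index * p = H.relIndex L := by
    rw [Subgroup.index_comap_of_surjective _ (QuotientGroup.mk'_surjective _), ← hcard, ← hZcard]
    exact Subgroup.index_mul_card Z
  let H' : Subgroup G := H''.map L.subtype
  have hH'L : H' ≤ L := by
    rintro _ ⟨y, -, rfl⟩
    exact y.2
  have hHH' : H ≤ H' := by
    intro y hy
    refine ⟨⟨y, hlt.le hy⟩, ?_, rfl⟩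
    change QuotientGroup.mk' _ _ ∈ Z
    have : QuotientGroup.mk' (H.subgroupOf L) ⟨y, hlt.le hy⟩ = 1 := by
      rw [QuotientGroup.mk'_apply, QuotientGroup.eq_one_iff, Subgroup.mem_subgroupOf]
      exact hy
    rw [this]
    exact Z.one_mem
  have hidx' : H'.index * p = p ^ (n + 1) := by
    rw [Subgroup.index_map_subtype, ← hidx, ← hri, ← hidx'']
    ring
  have hidx1 : H'.index = p ^ n := by
    rw [pow_succ] at hidx'
    exact Nat.eq_of_mul_eq_mul_right hp.pos hidx'
  refine ⟨H', ⟨?_, hidx1⟩, hHH', fun g hg => hnorm g (hH'L hg), ?_⟩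
  · refine isSubnormal_prepend hL hH'L ?_
    rintro g hg _ ⟨y, hy, rfl⟩
    refine ⟨⟨g, hg⟩ * y * ⟨g, hg⟩⁻¹, ?_, rfl⟩
    change QuotientGroup.mk' _ _ ∈ Z
    rw [map_mul, map_mul, map_inv]
    exact hZn _ _ hy
  · have h := Subgroup.relIndex_mul_index hHH'
    rw [hidx1, hidx, pow_succ'] at h
    exact Nat.eq_of_mul_eq_mul_right (pow_pos hp.pos n) h

/-- mod `p` rank -/
noncomputable def dd (p : ℕ) (H : Subgroup G) : ℕ := Module.finrank (ZMod p) (VV p H)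

theorem fg_of_mem_SS (hG : Group.FG G) {p n : ℕ} (hp : p.Prime) {H : Subgroup G}
    (hH : H ∈ SS G p n) : Group.FG H := by
  have : H.FiniteIndex := ⟨by rw [hH.2]; exact pow_ne_zero _ hp.ne_zero⟩
  infer_instance

theorem step_normal {p : ℕ} {K H : Subgroup G} (h : Step p K H) : (K.subgroupOf H).Normal := by
  refine ⟨fun x hx g => ?_⟩
  rw [Subgroup.mem_subgroupOf] at *
  exact h.2.1 g.1 g.2 x.1 hx

theorem step_ineq (hG : Group.FG G) {p n : ℕ} (hp : p.Prime) {K H : Subgroup G}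
    (hH : H ∈ SS G p n) (h : Step p K H) : dd p K + p ≤ p * dd p H + 1 := by
  have : Fact p.Prime := ⟨hp⟩
  have := step_normal h
  have := key_ineq (p := p) (fg_of_mem_SS hG hp hH) (K.subgroupOf H) h.2.2
  rw [VV_finrank_congr (Subgroup.subgroupOfEquivOfLe h.1)] at this
  exact this

theorem step_ineq_real (hG : Group.FG G) {p n : ℕ} (hp : p.Prime) {K H : Subgroup G}
    (hH : H ∈ SS G p n) (h : Step p K H) : (dd p K : ℝ) - 1 ≤ p * ((dd p H : ℝ) - 1) := by
  have := step_ineq hG hp hH h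
  have : (dd p K + p : ℝ) ≤ p * dd p H + 1 := by exact_mod_cast this
  linarith

/-- climb up from a subnormal subgroup of index `p ^ (n + j)` to index `p ^ n` -/
theorem climb (hG : Group.FG G) {p : ℕ} (hp : p.Prime) (n j : ℕ) {K : Subgroup G}
    (hK : K ∈ SS G p (n + j)) :
    ∃ H ∈ SS G p n, (dd p K : ℝ) - 1 ≤ (p : ℝ) ^ j * ((dd p H : ℝ) - 1) := by
  induction j generalizing K with
  | zero => exact ⟨K, hK, by simp⟩
  | succ j ih =>
    obtain ⟨K', hK', hs⟩ := exists_step hp (n := n + j) hK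
    obtain ⟨H, hH, hle⟩ := ih hK'
    refine ⟨H, hH, (step_ineq_real hG hp hK' hs).trans ?_⟩
    rw [pow_succ', mul_assoc]
    exact mul_le_mul_of_nonneg_left hle (Nat.cast_nonneg p)

/-- the kernel, as a subgroup of the ambient group -/
def kerG {p : ℕ} (H : Subgroup G) (f : VV p H) : Subgroup G := (VVker f).map H.subtype

theorem step_mem_SS {p n : ℕ} {K H : Subgroup G} (hH : H ∈ SS G p n) (h : Step p K H) :
    K ∈ SS G p (n + 1) := by
  refine ⟨isSubnormal_prepend hH.1 h.1 h.2.1, ?_⟩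
  rw [← Subgroup.relIndex_mul_index h.1, h.2.2, hH.2, pow_succ']

theorem step_kerG {p : ℕ} (hp : p.Prime) {H : Subgroup G} (f : VV p H) (x : H) (hx : f.1 x ≠ 0) :
    Step p (kerG H f) H := by
  have : Fact p.Prime := ⟨hp⟩
  refine ⟨?_, ?_, ?_⟩
  · rintro _ ⟨y, -, rfl⟩
    exact y.2
  · rintro g hg _ ⟨y, hy, rfl⟩
    refine ⟨⟨g, hg⟩ * y * ⟨g, hg⟩⁻¹, ?_, rfl⟩
    exact (VVker_normal f).conj_mem y hy _
  · have : (kerG H f).subgroupOf H = VVker f := by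
      unfold kerG
      rw [Subgroup.subgroupOf, Subgroup.comap_map_eq_self_of_injective H.subtype_injective]
    rw [Subgroup.relIndex, this]
    exact VVker_index f x hx

theorem exists_kerG {p : ℕ} (hp : p.Prime) {K H : Subgroup G} (h : Step p K H) :
    ∃ f : VV p H, kerG H f = K := by
  have : Fact p.Prime := ⟨hp⟩
  have := step_normal h
  obtain ⟨f, hf⟩ := exists_VV_of_index (p := p) (K.subgroupOf H) h.2.2
  refine ⟨f, ?_⟩
  unfold kerG
  rw [hf, Subgroup.subgroupOf_map_subtype, inf_eq_left]
  exact h.1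

theorem SS_zero {p : ℕ} : SS G p 0 = {⊤} := by
  ext H
  simp only [SS, pow_zero, Set.mem_ofPred_eq, Set.mem_singleton_iff, Subgroup.index_eq_one]
  constructor
  · exact fun h => h.2
  · rintro rfl
    exact ⟨⟨0, fun _ => ⊤, rfl, rfl, fun i hi => by omega⟩, rfl⟩

theorem SS_finite_card (hG : Group.FG G) {p : ℕ} (hp : p.Prime) (n : ℕ) (hfin : Finite (SS G p n)) :
    Finite (SS G p (n + 1)) ∧ ∀ D : ℕ, (∀ H ∈ SS G p n, dd p H ≤ D) →
      Nat.card (SS G p (n + 1)) ≤ Nat.card (SS G p n) * p ^ D := by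
  have : Fact p.Prime := ⟨hp⟩
  have hfinV : ∀ H : SS G p n, Finite (VV p H.1) := fun H =>
    VV_finite (fg_of_mem_SS hG hp H.2)
  let F : (Σ H : SS G p n, VV p H.1) → Subgroup G := fun a => kerG a.1.1 a.2
  have hsub : SS G p (n + 1) ⊆ Set.range F := by
    intro K hK
    obtain ⟨H, hH, hs⟩ := exists_step hp hK
    obtain ⟨f, hf⟩ := exists_kerG hp hs
    exact ⟨⟨⟨H, hH⟩, f⟩, hf⟩
  have hfr : (Set.range F).Finite := Set.finite_range F
  refine ⟨hfr.subset hsub, fun D hD => ?_⟩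
  have h1 : Nat.card (SS G p (n + 1)) ≤ Nat.card (Set.range F) := Nat.card_mono hfr hsub
  have h2 : Nat.card (Set.range F) ≤ Nat.card (Σ H : SS G p n, VV p H.1) :=
    Finite.card_range_le F
  refine (h1.trans h2).trans ?_
  have := Fintype.ofFinite (SS G p n)
  rw [Nat.card_sigma]
  refine (Finset.sum_le_card_nsmul _ _ (p ^ D) ?_).trans ?_
  · intro H _
    have : Module.Finite (ZMod p) (VV p H.1) := Module.Finite.of_finite
    rw [Module.natCard_eq_pow_finrank (K := ZMod p), Nat.card_zmod]
    exact Nat.pow_le_pow_right hp.pos (hD H.1 H.2)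
  · rw [smul_eq_mul, Nat.card_eq_fintype_card, Finset.card_univ]

theorem SS_finite (hG : Group.FG G) {p : ℕ} (hp : p.Prime) (n : ℕ) : Finite (SS G p n) := by
  induction n with
  | zero => rw [SS_zero]; infer_instance
  | succ n ih => exact (SS_finite_card hG hp n ih).1

theorem subnormalCount_eq (p n : ℕ) : subnormalCount G (p ^ n) = Nat.card (SS G p n) := rfl

theorem count_lower (hG : Group.FG G) {p n : ℕ} (hp : p.Prime) {H : Subgroup G}
    (hH : H ∈ SS G p n) (hd : 1 ≤ dd p H) : p ^ (dd p H - 1) ≤ Nat.card (SS G p (n + 1)) := by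
  have : Fact p.Prime := ⟨hp⟩
  have : Finite (VV p H) := VV_finite (fg_of_mem_SS hG hp hH)
  have : Module.Finite (ZMod p) (VV p H) := Module.Finite.of_finite
  have hnt : Nontrivial (VV p H) := Module.nontrivial_of_finrank_pos (R := ZMod p) hd
  obtain ⟨φ, hφ⟩ := exists_ne (0 : VV p H)
  obtain ⟨x, hx⟩ : ∃ x, φ.1 x ≠ 0 := by
    by_contra hcon
    push Not at hcon
    exact hφ (Subtype.ext (funext hcon))
  let evx : VV p H →ₗ[ZMod p] ZMod p :=
    { toFun := fun f => f.1 x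
      map_add' := fun _ _ => rfl
      map_smul' := fun _ _ => rfl }
  have h3 := finrank_ker_functional evx φ hx
  have h4 : dd p H - 1 = Module.finrank (ZMod p) (LinearMap.ker evx) := by
    unfold dd; omega
  have hval : ∀ f : LinearMap.ker evx, (f.1 + φ).1 x = φ.1 x := by
    intro f
    have : f.1.1 x = 0 := f.2
    change f.1.1 x + φ.1 x = φ.1 x
    rw [this, zero_add]
  have := SS_finite hG hp (n + 1)
  let F : LinearMap.ker evx → SS G p (n + 1) := fun f =>
    ⟨kerG H (f.1 + φ), step_mem_SS hH (step_kerG hp _ x (by rw [hval]; exact hx))⟩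
  have hF : Function.Injective F := by
    intro f g hfg
    have h1 : kerG H (f.1 + φ) = kerG H (g.1 + φ) := congrArg Subtype.val hfg
    have h2 : VVker (f.1 + φ) = VVker (g.1 + φ) :=
      Subgroup.map_injective H.subtype_injective h1
    have h5 : f.1 + φ = g.1 + φ := by
      apply Subtype.ext
      funext h
      set A := f.1 + φ with hA
      set B := g.1 + φ with hB
      have hAx : A.1 x = φ.1 x := hval f
      have hBx : B.1 x = φ.1 x := hval g
      let m : ℤ := ((A.1 h / φ.1 x).val : ℤ)
      have hm : (m : ZMod p) * φ.1 x = A.1 h := by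
        simp only [m]
        rw [Int.cast_natCast, ZMod.natCast_zmod_val, div_mul_cancel₀ _ hx]
      have hmem : h * x ^ (-m) ∈ VVker A := by
        rw [mem_VVker, VV_mul, VV_zpow, hAx]
        push_cast
        linear_combination -hm
      rw [h2, mem_VVker, VV_mul, VV_zpow, hBx] at hmem
      push_cast at hmem
      linear_combination -hmem - hm
    exact Subtype.ext (add_right_cancel h5)
  have h6 := Nat.card_le_card_of_injective F hF
  rw [Module.natCard_eq_pow_finrank (K := ZMod p), Nat.card_zmod, ← h4] at h6
  exact h6

end Subn

/-! ### Kőnig's lemma and asymptotics -/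

theorem konig_seq {X : ℕ → Type*} [∀ n, Finite (X n)] [∀ n, Nonempty (X n)]
    (f : ∀ n, X (n + 1) → X n) : ∃ s : ∀ n, X n, ∀ n, f n (s (n + 1)) = s n := by
  let F : CategoryTheory.Functor ℕᵒᵖ (Type _) := CategoryTheory.Functor.ofOpSequence (X := X)
    (fun n => TypeCat.ofHom (f n))
  have h1 : ∀ j : ℕᵒᵖ, Finite (F.obj j) := fun j => inferInstanceAs (Finite (X j.unop))
  have h2 : ∀ j : ℕᵒᵖ, Nonempty (F.obj j) := fun j => inferInstanceAs (Nonempty (X j.unop))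
  obtain ⟨s, hs⟩ := nonempty_sections_of_finite_inverse_system F
  refine ⟨fun n => s (Opposite.op n), fun n => ?_⟩
  have := hs (CategoryTheory.homOfLE (Nat.le_add_right n 1)).op
  rw [CategoryTheory.Functor.ofOpSequence_map_homOfLE_succ] at this
  exact this

section Asym

variable {G : Type*} [Group G]

theorem log_count_upper (hG : Group.FG G) {p : ℕ} (hp : p.Prime) (k : ℕ) (ε : ℝ) (hε : 0 ≤ ε)
    (hk : ∀ H ∈ SS G p k, (dd p H : ℝ) - 1 ≤ ε * (p : ℝ) ^ k) (j : ℕ) :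
    Real.log (Nat.card (SS G p (k + j))) ≤
      Real.log (Nat.card (SS G p k)) + Real.log p * (j + ε * (p : ℝ) ^ (k + j)) := by
  have hp2 : (2 : ℝ) ≤ p := by exact_mod_cast hp.two_le
  have hlp : 0 < Real.log p := Real.log_pos (by linarith)
  have hall : ∀ j, ∀ H ∈ SS G p (k + j), (dd p H : ℝ) - 1 ≤ ε * (p : ℝ) ^ (k + j) := by
    intro j K hK
    obtain ⟨H, hH, hle⟩ := climb hG hp k j hK
    refine hle.trans ?_
    have := mul_le_mul_of_nonneg_left (hk H hH) (show (0 : ℝ) ≤ (p : ℝ) ^ j by positivity)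
    refine this.trans (le_of_eq ?_)
    rw [pow_add]; ring
  induction j with
  | zero =>
    have : 0 ≤ Real.log p * (((0 : ℕ) : ℝ) + ε * (p : ℝ) ^ (k + 0)) := by positivity
    simpa using this
  | succ j ih =>
    have hpk : (0 : ℝ) < (p : ℝ) ^ (k + j) := by positivity
    have hx : 0 ≤ 1 + ε * (p : ℝ) ^ (k + j) := by positivity
    have hcard := (SS_finite_card hG hp (k + j) (SS_finite hG hp _)).2
      ⌊1 + ε * (p : ℝ) ^ (k + j)⌋₊ (by
        intro H hH
        apply Nat.le_floor
        have := hall j H hH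
        linarith)
    have hfl := Nat.floor_le hx
    set D := ⌊1 + ε * (p : ℝ) ^ (k + j)⌋₊ with hD
    have hstep : Real.log (Nat.card (SS G p (k + (j + 1)))) ≤
        Real.log (Nat.card (SS G p (k + j))) + D * Real.log p := by
      rcases Nat.eq_zero_or_pos (Nat.card (SS G p (k + (j + 1)))) with h0 | hpos
      · rw [h0, Nat.cast_zero, Real.log_zero]
        have := Real.log_natCast_nonneg (Nat.card (SS G p (k + j)))
        positivity
      · have hcard' : Nat.card (SS G p (k + (j + 1))) ≤ Nat.card (SS G p (k + j)) * p ^ D := hcard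
        have hpos' : Nat.card (SS G p (k + j)) ≠ 0 := by
          intro h
          rw [h, zero_mul] at hcard'
          omega
        have hpD : ((p : ℝ) ^ D) ≠ 0 := by positivity
        rw [← Real.log_pow, ← Real.log_mul (by exact_mod_cast hpos') hpD]
        apply Real.log_le_log (by exact_mod_cast hpos)
        exact_mod_cast hcard'
    have h2 : (D : ℝ) * Real.log p ≤ (1 + ε * (p : ℝ) ^ (k + j)) * Real.log p :=
      mul_le_mul_of_nonneg_right hfl hlp.le
    have h3 : 2 * (ε * (p : ℝ) ^ (k + j)) ≤ ε * (p : ℝ) ^ (k + (j + 1)) := by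
      rw [← add_assoc, pow_succ]
      have : 0 ≤ ε * (p : ℝ) ^ (k + j) := by positivity
      nlinarith
    have h4 := mul_le_mul_of_nonneg_left h3 hlp.le
    push_cast
    nlinarith

theorem one_imp_three (hG : Group.FG G) {p : ℕ} (hp : p.Prime)
    (h : ∃ Gs : ℕ → Subgroup G,
        (∀ i, Gs (i + 1) < Gs i) ∧ (∀ i, IsSubnormal (Gs i)) ∧
        (∀ i, ∃ k : ℕ, (Gs i).index = p ^ k) ∧ LinearGrowthModP p Gs) :
    ∃ c : ℝ, 0 < c ∧ ∀ n : ℕ, 1 ≤ n →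
        c ≤ Real.log (subnormalCount G (p ^ n)) / (p : ℝ) ^ n := by
  have : Fact p.Prime := ⟨hp⟩
  have hp2 : (2 : ℝ) ≤ p := by exact_mod_cast hp.two_le
  have hp0 : (0 : ℝ) < p := by linarith
  have hlp : 0 < Real.log p := Real.log_pos (by linarith)
  obtain ⟨Gs, hlt, hsub, hidx, c, hc, hgr⟩ := h
  choose k hk using hidx
  have hmono : StrictMono k := by
    apply strictMono_nat_of_lt_succ
    intro i
    have : (Gs (i + 1)).FiniteIndex := ⟨by rw [hk]; exact pow_ne_zero _ hp.ne_zero⟩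
    have := Subgroup.index_strictAnti (hlt i)
    rw [hk, hk] at this
    exact (Nat.pow_lt_pow_iff_right hp.one_lt).1 this
  refine ⟨c / 2 * Real.log p / p, by positivity, ?_⟩
  intro n hn
  obtain ⟨m, rfl⟩ : ∃ m, n = m + 1 := ⟨n - 1, by omega⟩
  obtain ⟨i₀, hi₀⟩ := pow_unbounded_of_one_lt (2 / c) (show (1 : ℝ) < p by linarith)
  let i := max i₀ m
  have hki : i ≤ k i := hmono.le_apply
  obtain ⟨j, hj⟩ : ∃ j, k i = m + j := ⟨k i - m, by have := le_max_right i₀ m; omega⟩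
  have hK : Gs i ∈ SS G p (m + j) := ⟨hsub i, by rw [hk, hj]⟩
  obtain ⟨H, hH, hle⟩ := climb hG hp m j hK
  have hbig : 2 / c ≤ (p : ℝ) ^ (m + j) := by
    refine hi₀.le.trans ?_
    apply pow_le_pow_right₀ (by linarith)
    rw [← hj]
    exact (le_max_left i₀ m).trans hki
  have hgi := hgr i
  rw [hk, hj, dp_eq] at hgi
  change c ≤ (dd p (Gs i) : ℝ) / _ at hgi
  push_cast at hgi
  have hpmj : (0 : ℝ) < (p : ℝ) ^ (m + j) := by positivity
  rw [le_div_iff₀ hpmj] at hgi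
  rw [div_le_iff₀ hc] at hbig
  have h1 : (p : ℝ) ^ j * (c / 2 * (p : ℝ) ^ m) ≤ (p : ℝ) ^ j * ((dd p H : ℝ) - 1) := by
    refine le_trans ?_ hle
    have : (p : ℝ) ^ j * (c / 2 * (p : ℝ) ^ m) = c / 2 * (p : ℝ) ^ (m + j) := by
      rw [pow_add]; ring
    rw [this]
    linarith
  have h2 : c / 2 * (p : ℝ) ^ m ≤ (dd p H : ℝ) - 1 :=
    le_of_mul_le_mul_left h1 (by positivity)
  have h3 : (1 : ℝ) < dd p H := by
    have : 0 < c / 2 * (p : ℝ) ^ m := by positivity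
    linarith
  have h4 : 1 ≤ dd p H := by
    have : 1 < dd p H := by exact_mod_cast h3
    omega
  have h5 := count_lower hG hp hH h4
  rw [subnormalCount_eq]
  have h6 : ((dd p H : ℝ) - 1) * Real.log p ≤ Real.log (Nat.card (SS G p (m + 1))) := by
    have : ((dd p H : ℝ) - 1) = ((dd p H - 1 : ℕ) : ℝ) := by push_cast [h4]; rfl
    rw [this, ← Real.log_pow]
    apply Real.log_le_log (by positivity)
    exact_mod_cast h5
  rw [le_div_iff₀ (by positivity)]
  refine le_trans ?_ h6
  refine le_trans (le_of_eq ?_) (mul_le_mul_of_nonneg_right h2 hlp.le)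
  rw [pow_succ]
  field_simp

theorem three_imp_two (hG : Group.FG G) {p : ℕ} (hp : p.Prime)
    (h : ∃ c : ℝ, 0 < c ∧ ∀ n : ℕ, 1 ≤ n →
        c ≤ Real.log (subnormalCount G (p ^ n)) / (p : ℝ) ^ n) :
    0 < Filter.limsup
        (fun n : ℕ => Real.log (subnormalCount G (p ^ n)) / (p : ℝ) ^ n) Filter.atTop := by
  have hp2 : (2 : ℝ) ≤ p := by exact_mod_cast hp.two_le
  have hp0 : (0 : ℝ) < p := by linarith
  have hlp : 0 < Real.log p := Real.log_pos (by linarith)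
  obtain ⟨c, hc, hcn⟩ := h
  refine lt_of_lt_of_le hc (Filter.le_limsup_of_frequently_le ?_ ?_)
  · apply Filter.Eventually.frequently
    filter_upwards [Filter.eventually_ge_atTop 1] with n hn using hcn n hn
  · refine Filter.isBoundedUnder_of ⟨Real.log p * (1 + (dd p (⊤ : Subgroup G) : ℝ)), fun n => ?_⟩
    have := log_count_upper hG hp 0 (dd p (⊤ : Subgroup G) : ℝ) (Nat.cast_nonneg _) (by
      intro H hH
      rw [SS_zero, Set.mem_singleton_iff] at hH
      rw [hH]; simp) n
    have hcz : Nat.card (SS G p 0) = 1 := by rw [SS_zero]; simp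
    rw [hcz, Nat.cast_one, Real.log_one, zero_add, zero_add] at this
    have hpn : (0 : ℝ) < (p : ℝ) ^ n := by positivity
    change _ / _ ≤ _
    rw [subnormalCount_eq, div_le_iff₀ hpn]
    refine this.trans ?_
    rw [mul_assoc]
    apply mul_le_mul_of_nonneg_left _ hlp.le
    have hn : (n : ℝ) ≤ (p : ℝ) ^ n := by
      exact_mod_cast (Nat.lt_pow_self hp.one_lt).le
    linarith

theorem two_imp_one (hG : Group.FG G) {p : ℕ} (hp : p.Prime)
    (h : 0 < Filter.limsup
        (fun n : ℕ => Real.log (subnormalCount G (p ^ n)) / (p : ℝ) ^ n) Filter.atTop) :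
    ∃ Gs : ℕ → Subgroup G,
        (∀ i, Gs (i + 1) < Gs i) ∧ (∀ i, IsSubnormal (Gs i)) ∧
        (∀ i, ∃ k : ℕ, (Gs i).index = p ^ k) ∧ LinearGrowthModP p Gs := by
  have : Fact p.Prime := ⟨hp⟩
  have hp2 : (2 : ℝ) ≤ p := by exact_mod_cast hp.two_le
  have hp0 : (0 : ℝ) < p := by linarith
  have hp1 : (1 : ℝ) < p := by linarith
  have hlp : 0 < Real.log p := Real.log_pos (by linarith)
  set l := Filter.limsup
        (fun n : ℕ => Real.log (subnormalCount G (p ^ n)) / (p : ℝ) ^ n) Filter.atTop with hl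
  -- the linear growth constant
  obtain ⟨ε, hε, hgood⟩ : ∃ ε : ℝ, 0 < ε ∧ ∀ k, ∃ H ∈ SS G p k,
      ε * (p : ℝ) ^ k ≤ (dd p H : ℝ) - 1 := by
    by_contra hcon
    push Not at hcon
    let ε := l / (3 * Real.log p)
    have hε : 0 < ε := by positivity
    obtain ⟨k, hk⟩ := hcon ε hε
    have hup := log_count_upper hG hp k ε hε.le (fun H hH => (hk H hH).le)
    have ht1 : Filter.Tendsto (fun n : ℕ => Real.log (Nat.card (SS G p k)) * ((n : ℝ) ^ 0 / (p : ℝ) ^ n)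
        + Real.log p * ((n : ℝ) ^ 1 / (p : ℝ) ^ n)) Filter.atTop (nhds 0) := by
      have a1 := (tendsto_pow_const_div_const_pow_of_one_lt 0 hp1).const_mul
        (Real.log (Nat.card (SS G p k)))
      have a2 := (tendsto_pow_const_div_const_pow_of_one_lt 1 hp1).const_mul (Real.log p)
      simpa using a1.add a2
    have hev := ht1.eventually (gt_mem_nhds (show (0 : ℝ) < l / 3 by positivity))
    have hle : l ≤ 2 * l / 3 := by
      rw [hl]
      refine Filter.limsup_le_of_le (Filter.isCoboundedUnder_le_of_le _ (x := 0) ?_) ?_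
      · intro n
        have := Real.log_natCast_nonneg (subnormalCount G (p ^ n))
        positivity
      · filter_upwards [hev, Filter.eventually_ge_atTop k] with n hn hkn
        obtain ⟨j, rfl⟩ := Nat.exists_eq_add_of_le hkn
        have hu := hup j
        rw [subnormalCount_eq, ← hl]
        have hpn : (0 : ℝ) < (p : ℝ) ^ (k + j) := by positivity
        rw [div_le_iff₀ hpn]
        have hn' : Real.log (Nat.card (SS G p k)) + Real.log p * ((k + j : ℕ) : ℝ)
            < l / 3 * (p : ℝ) ^ (k + j) := by
          have := mul_lt_mul_of_pos_right hn hpn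
          refine lt_of_eq_of_lt ?_ this
          field_simp
        have he : Real.log p * (ε * (p : ℝ) ^ (k + j)) = l / 3 * (p : ℝ) ^ (k + j) := by
          simp only [ε]
          field_simp
        have hj : Real.log p * (j : ℝ) ≤ Real.log p * ((k + j : ℕ) : ℝ) := by
          apply mul_le_mul_of_nonneg_left _ hlp.le
          push_cast
          have : (0 : ℝ) ≤ k := Nat.cast_nonneg k
          linarith
        rw [mul_add, he] at hu
        linarith
    linarith
  let X : ℕ → Type _ := fun k => {H : Subgroup G // H ∈ SS G p k ∧
    ε * (p : ℝ) ^ k ≤ (dd p H : ℝ) - 1}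
  have hXf : ∀ n, Finite (X n) := by
    intro n
    have := SS_finite hG hp n
    exact Finite.of_injective (fun H : X n => (⟨H.1, H.2.1⟩ : SS G p n)) (by
      intro a b hab
      exact Subtype.ext (congrArg (fun z : SS G p n => z.1) hab))
  have hXn : ∀ n, Nonempty (X n) := by
    intro n
    obtain ⟨H, hH, hd⟩ := hgood n
    exact ⟨⟨H, hH, hd⟩⟩
  have hpar : ∀ n (K : X (n + 1)), ∃ H : X n, Step p K.1 H.1 := by
    intro n K
    obtain ⟨H, hH, hs⟩ := exists_step hp K.2.1
    refine ⟨⟨H, hH, ?_⟩, hs⟩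
    have h1 := step_ineq_real hG hp hH hs
    have h2 := K.2.2.trans h1
    rw [pow_succ'] at h2
    have h3 : (p : ℝ) * (ε * (p : ℝ) ^ n) ≤ p * ((dd p H : ℝ) - 1) := by
      refine le_trans (le_of_eq ?_) h2
      ring
    exact le_of_mul_le_mul_left h3 hp0
  choose f hf using hpar
  obtain ⟨s, hs⟩ := konig_seq f
  have hstep : ∀ n, Step p (s (n + 1)).1 (s n).1 := by
    intro n
    have := hf n (s (n + 1))
    rwa [hs n] at this
  refine ⟨fun n => (s n).1, ?_, fun i => (s i).2.1.1, fun i => ⟨i, (s i).2.1.2⟩, ε, hε, ?_⟩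
  · intro i
    refine lt_of_le_of_ne (hstep i).1 ?_
    intro he
    have h1 := (s (i + 1)).2.1.2
    have h2 := (s i).2.1.2
    simp only at he
    rw [he, h2] at h1
    exact absurd (Nat.pow_right_injective hp.two_le h1) (by omega)
  · intro i
    have h1 := (s i).2.2
    rw [(s i).2.1.2, dp_eq]
    change ε ≤ (dd p (s i).1 : ℝ) / _
    push_cast
    rw [le_div_iff₀ (by positivity)]
    linarith

end Asym

/-- **Theorem 8.1** (parts (i), (iii), (iv)): for a finitely generated group `G` and a
prime `p`, the existence of an infinite strictly nested sequence of subnormal subgroups of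
`p`-power index with linear growth of mod `p` homology is equivalent to
`limsup (log a_{p^n}^{⊳⊳}(G))/p^n > 0` and to `inf_{n ≥ 1} (log a_{p^n}^{⊳⊳}(G))/p^n > 0`. -/
theorem statement9 {G : Type*} [Group G] (hG : Group.FG G) (p : ℕ) (hp : p.Prime) :
    List.TFAE [
      (∃ Gs : ℕ → Subgroup G,
        (∀ i, Gs (i + 1) < Gs i) ∧ (∀ i, IsSubnormal (Gs i)) ∧
        (∀ i, ∃ k : ℕ, (Gs i).index = p ^ k) ∧ LinearGrowthModP p Gs),
      0 < Filter.limsup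
        (fun n : ℕ => Real.log (subnormalCount G (p ^ n)) / (p : ℝ) ^ n) Filter.atTop,
      ∃ c : ℝ, 0 < c ∧ ∀ n : ℕ, 1 ≤ n →
        c ≤ Real.log (subnormalCount G (p ^ n)) / (p : ℝ) ^ n] := by

  tfae_have 1 → 3 := one_imp_three hG hp
  tfae_have 3 → 2 := three_imp_two hG hp
  tfae_have 2 → 1 := two_imp_one hG hp
  tfae_finish
end

section
/- Let G be a finitely generated group and let p be a prime. For each i ≥ 0, let r_i = max{ d_p(H) : H is a subnormal subgroup of G with [G:H] = p^i } (with r_i = 0 if no such subgroup exists; this is a maximum over a finite set). Then for every n ≥ 1, the number a_{p^n}^{⊳⊳}(G) of subnormal subgroups of G of index exactly p^n satisfies a_{p^n}^{⊳⊳}(G) ≤ p^{r_0 + r_1 + ⋯ + r_{n−1}}. -/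
open scoped TensorProduct

lemma card_hom_eq {K : Type*} [Group K] [Group.FG K] (p : ℕ) [Fact p.Prime] :
    Finite (K →* Multiplicative (ZMod p)) ∧
      Nat.card (K →* Multiplicative (ZMod p)) = p ^ dp p K := by
  have hfg : Module.Finite ℤ (Additive (Abelianization K)) := by
    have h1 : Group.FG (Abelianization K) :=
      Group.fg_of_surjective (f := Abelianization.of) QuotientGroup.mk_surjective
    have h2 : AddGroup.FG (Additive (Abelianization K)) := AddGroup.fg_iff_mul_fg.2 h1
    exact Module.Finite.iff_addGroup_fg.2 h2
  let e : (K →* Multiplicative (ZMod p)) ≃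
      Module.Dual (ZMod p) (ZMod p ⊗[ℤ] Additive (Abelianization K)) :=
    (Abelianization.lift.trans MonoidHom.toAdditiveLeft).trans
      ((addMonoidHomLequivInt ℤ).toEquiv.trans (LinearMap.liftBaseChangeEquiv (ZMod p)).toEquiv)
  have hf : Finite (Module.Dual (ZMod p) (ZMod p ⊗[ℤ] Additive (Abelianization K))) :=
    Module.finite_of_finite (ZMod p)
  refine ⟨Finite.of_equiv _ e.symm, ?_⟩
  rw [Nat.card_congr e, Module.natCard_eq_pow_finrank (K := ZMod p), Subspace.dual_finrank_eq,
    Nat.card_zmod]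
  rfl

lemma IsSubnormal.of_step {G : Type*} [Group G] {K L : Subgroup G} (hL : IsSubnormal L)
    (hKL : K ≤ L) (hn : ∀ g ∈ L, ∀ x ∈ K, g * x * g⁻¹ ∈ K) : IsSubnormal K := by
  obtain ⟨n, c, h0, hn', hc⟩ := hL
  refine ⟨n + 1, fun i => Nat.casesOn i K c, rfl, hn', ?_⟩
  intro i hi
  cases i with
  | zero => simpa [h0] using ⟨hKL, hn⟩
  | succ i => exact hc i (by omega)

/-- A proper subnormal subgroup is normal in a strictly larger subnormal subgroup. -/
lemma IsSubnormal.exists_step {G : Type*} [Group G] {H : Subgroup G} (hH : IsSubnormal H)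
    (hne : H ≠ ⊤) : ∃ L, IsSubnormal L ∧ H < L ∧ ∀ g ∈ L, ∀ x ∈ H, g * x * g⁻¹ ∈ H := by
  obtain ⟨n, c, h0, hn, hc⟩ := hH
  induction n generalizing c with
  | zero => exact absurd (h0.symm.trans hn) hne
  | succ n ih =>
    by_cases h : c 1 = H
    · exact ih (fun i => c (i + 1)) h hn (fun i hi => hc (i + 1) (by omega))
    · have h1 := hc 0 (by omega)
      simp only [h0, zero_add] at h1
      exact ⟨c 1, ⟨n, fun i => c (i + 1), rfl, hn, fun i hi => hc (i + 1) (by omega)⟩,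
        lt_of_le_of_ne h1.1 (Ne.symm h), h1.2⟩

lemma exists_parent {G : Type*} [Group G] (p : ℕ) [hp : Fact p.Prime] (n : ℕ) (H : Subgroup G)
    (hH : IsSubnormal H) (hi : H.index = p ^ (n + 1)) :
    ∃ K : Subgroup G, (IsSubnormal K ∧ K.index = p ^ n) ∧
      ∃ f : K →* Multiplicative (ZMod p), H = f.ker.map K.subtype := by
  have hne : H ≠ ⊤ := by
    rintro rfl
    rw [Subgroup.index_top] at hi
    exact absurd hi.symm (Nat.one_lt_pow (by omega) hp.out.one_lt).ne'
  obtain ⟨L, hL, hlt, hnorm⟩ := hH.exists_step hne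
  have hN : (H.subgroupOf L).Normal :=
    (Subgroup.normal_subgroupOf_iff hlt.le).2 fun h k hh hk => hnorm k hk h hh
  set N := H.subgroupOf L with hNdef
  have hNi : N.index * L.index = p ^ (n + 1) := by
    rw [← hi]; exact Subgroup.relIndex_mul_index hlt.le
  obtain ⟨k, -, hk⟩ := (Nat.dvd_prime_pow hp.out).1 (Dvd.intro _ hNi)
  have hcard : Nat.card (L ⧸ N) = p ^ k := hk
  have hfin : Finite (L ⧸ N) := Nat.finite_of_card_ne_zero (by
    rw [hcard]; exact (pow_pos hp.out.pos k).ne')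
  have hP : IsPGroup p (L ⧸ N) := IsPGroup.of_card hcard
  have hnt : Nontrivial (L ⧸ N) := by
    rw [QuotientGroup.nontrivial_iff]
    intro h
    exact hlt.not_ge (Subgroup.subgroupOf_eq_top.1 h)
  have hcn := hP.center_nontrivial
  have hdvd : p ∣ Nat.card (Subgroup.center (L ⧸ N)) := by
    obtain ⟨m, hm, h⟩ := (hP.to_subgroup (Subgroup.center (L ⧸ N))).nontrivial_iff_card.1 hcn
    rw [h]; exact dvd_pow_self p (by omega)
  obtain ⟨z, hz⟩ := exists_prime_orderOf_dvd_card' p hdvd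
  set Z := Subgroup.zpowers (z : L ⧸ N) with hZ
  have hZc : Z ≤ Subgroup.center (L ⧸ N) := Subgroup.zpowers_le.2 z.2
  have hZcard : Nat.card Z = p := by
    rw [Nat.card_zpowers, Subgroup.orderOf_coe, hz]
  set M := Z.comap (QuotientGroup.mk' N) with hM
  have hNM : N ≤ M := by
    intro x hx
    have : (QuotientGroup.mk' N) x = 1 := (QuotientGroup.eq_one_iff x).2 hx
    rw [hM, Subgroup.mem_comap, this]
    exact one_mem _
  have hrel : N.relIndex M = p := by
    conv_lhs => rw [← QuotientGroup.ker_mk' N]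
    rw [Subgroup.relIndex_ker, hM,
      Subgroup.map_comap_eq_self_of_surjective (QuotientGroup.mk'_surjective N), hZcard]
  set K := M.map L.subtype with hK
  have hKL : K ≤ L := Subgroup.map_subtype_le M
  have hNH : N.map L.subtype = H := Subgroup.map_subgroupOf_eq_of_le hlt.le
  have hHK : H ≤ K := by rw [← hNH]; exact Subgroup.map_mono hNM
  have hrelK : H.relIndex K = p := by
    rw [← hrel, ← Subgroup.relIndex_map_map_of_injective N M L.subtype_injective, hNH]
  have hMn : ∀ g x : L, x ∈ M → g * x * g⁻¹ ∈ M := by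
    intro g x hx
    rw [hM, Subgroup.mem_comap] at hx ⊢
    have hc := Subgroup.mem_center_iff.1 (hZc hx) (QuotientGroup.mk' N g)
    rw [map_mul, map_mul, hc, map_inv, mul_inv_cancel_right]
    exact hx
  have hKs : IsSubnormal K := by
    refine hL.of_step hKL ?_
    rintro g hg _ ⟨x, hx, rfl⟩
    exact ⟨⟨g, hg⟩ * x * ⟨g, hg⟩⁻¹, hMn _ _ hx, rfl⟩
  have hHKn : (H.subgroupOf K).Normal :=
    (Subgroup.normal_subgroupOf_iff hHK).2 fun h k hh hk => hnorm k (hKL hk) h hh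
  refine ⟨K, ⟨hKs, ?_⟩, ?_⟩
  · have := Subgroup.relIndex_mul_index hHK
    rw [hrelK, hi, pow_succ'] at this
    exact Nat.eq_of_mul_eq_mul_left hp.out.pos this
  · have hq : Nat.card (K ⧸ H.subgroupOf K) = p := hrelK
    let e : (K ⧸ H.subgroupOf K) ≃* Multiplicative (ZMod p) :=
      mulEquivOfPrimeCardEq hq (Nat.card_zmod p)
    refine ⟨(e : (K ⧸ H.subgroupOf K) →* Multiplicative (ZMod p)).comp (QuotientGroup.mk' _), ?_⟩
    rw [MonoidHom.ker_mulEquiv_comp, QuotientGroup.ker_mk',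
      Subgroup.map_subgroupOf_eq_of_le hHK]

lemma count_aux {G : Type*} [Group G] (hG : Group.FG G) (p : ℕ) [hp : Fact p.Prime] (n : ℕ) :
    Finite {H : Subgroup G // IsSubnormal H ∧ H.index = p ^ n} ∧
      subnormalCount G (p ^ n) ≤
        p ^ (∑ i ∈ Finset.range n,
          sSup {d : ℕ | ∃ H : Subgroup G, IsSubnormal H ∧ H.index = p ^ i ∧ dp p ↥H = d}) := by
  induction n with
  | zero =>
    have : Subsingleton {H : Subgroup G // IsSubnormal H ∧ H.index = p ^ 0} := by
      constructor
      rintro ⟨a, -, ha⟩ ⟨b, -, hb⟩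
      rw [pow_zero, Subgroup.index_eq_one] at ha hb
      simp [ha, hb]
    refine ⟨inferInstance, ?_⟩
    simpa [subnormalCount] using Finite.card_le_one_iff_subsingleton.2 this
  | succ n ih =>
    obtain ⟨hfin, hle⟩ := ih
    have hhom : ∀ K : {H : Subgroup G // IsSubnormal H ∧ H.index = p ^ n},
        Finite (K.1 →* Multiplicative (ZMod p)) ∧
          Nat.card (K.1 →* Multiplicative (ZMod p)) = p ^ dp p K.1 := by
      intro K
      have : K.1.FiniteIndex := ⟨by rw [K.2.2]; exact (pow_pos hp.out.pos n).ne'⟩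
      exact card_hom_eq p
    have hfin' := fun K => (hhom K).1
    have hex : ∀ H : {H : Subgroup G // IsSubnormal H ∧ H.index = p ^ (n + 1)},
        ∃ s : (Σ K : {H : Subgroup G // IsSubnormal H ∧ H.index = p ^ n},
          (K.1 →* Multiplicative (ZMod p))), H.1 = s.2.ker.map s.1.1.subtype := by
      intro H
      obtain ⟨K, hK, f, hf⟩ := exists_parent p n H.1 H.2.1 H.2.2
      exact ⟨⟨⟨K, hK⟩, f⟩, hf⟩
    choose s hs using hex
    have hinj : Function.Injective s := by
      intro a b hab
      apply Subtype.ext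
      rw [hs a, hs b, hab]
    refine ⟨Finite.of_injective s hinj, ?_⟩
    have hbdd : BddAbove {d : ℕ | ∃ H : Subgroup G,
        IsSubnormal H ∧ H.index = p ^ n ∧ dp p ↥H = d} := by
      have h := Set.finite_range (fun K : {H : Subgroup G // IsSubnormal H ∧ H.index = p ^ n} =>
        dp p K.1)
      refine (h.subset ?_).bddAbove
      rintro d ⟨H, h1, h2, h3⟩
      exact ⟨⟨H, h1, h2⟩, h3⟩
    have := Fintype.ofFinite {H : Subgroup G // IsSubnormal H ∧ H.index = p ^ n}
    rw [Finset.sum_range_succ, pow_add p (∑ i ∈ Finset.range n, _)]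
    refine (Nat.card_le_card_of_injective s hinj).trans ?_
    rw [Nat.card_sigma]
    refine le_trans ?_ (Nat.mul_le_mul_right _ hle)
    rw [subnormalCount, Nat.card_eq_fintype_card, ← smul_eq_mul]
    refine Finset.sum_le_card_nsmul _ _ _ fun K _ => ?_
    rw [(hhom K).2]
    exact Nat.pow_le_pow_right hp.out.pos (le_csSup hbdd ⟨K.1, K.2.1, K.2.2, rfl⟩)

/-- The counting step in the proof of (iii) ⟹ (i) of **Theorem 8.1**: with
`r_i = max { d_p(H) : H subnormal in G, [G:H] = p^i }` (and `r_i = 0` if there is no such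
subgroup), one has `a_{p^n}^{⊳⊳}(G) ≤ p^{r_0 + r_1 + ⋯ + r_{n-1}}` for all `n ≥ 1`. -/
theorem statement11 {G : Type*} [Group G] (hG : Group.FG G) (p : ℕ) (hp : p.Prime) :
    ∀ n : ℕ, 1 ≤ n →
      subnormalCount G (p ^ n) ≤
        p ^ (∑ i ∈ Finset.range n,
          sSup {d : ℕ | ∃ H : Subgroup G, IsSubnormal H ∧ H.index = p ^ i ∧ dp p ↥H = d}) := by
  intro n _
  have : Fact p.Prime := ⟨hp⟩
  exact (count_aux hG p n).2
end
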